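/- With V, N, τ, τ_min, and c_e as in the extended cost function definition, for every node v ∈ V and every S ⊆ V with v ∉ S, the marginal cost satisfies c_e({v}) ≤ c_e(S ∪ {v}) − c_e(S), i.e., singleton cost lower-bounds every marginal cost. -/

import Mathlib

/-- The cost that a node with nonempty neighborhood `M` pays when the set `S` is selected. -/
noncomputable def nodeCost {V : Type*} [DecidableEq V] (M : Finset V) (hM : M.Nonempty)
    (f : V → ℝ) (S : Finset V) : ℝ :=
  if h : (S ∩ M).Nonempty then (S ∩ M).sup' h f else M.inf' hM f

theorem inf'_le_nodeCost {V : Type*} [DecidableEq V] (M : Finset V) (hM : M.Nonempty)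
    (f : V → ℝ) (S : Finset V) : M.inf' hM f ≤ nodeCost M hM f S := by
  unfold nodeCost
  split_ifs with h
  · obtain ⟨u, hu⟩ := h
    exact (Finset.inf'_le f (Finset.mem_inter.mp hu).2).trans (Finset.le_sup' f hu)
  · exact le_rfl

theorem nodeCost_mono {V : Type*} [DecidableEq V] (M : Finset V) (hM : M.Nonempty)
    (f : V → ℝ) : Monotone (nodeCost M hM f) := by
  intro S T hST
  by_cases hS : (S ∩ M).Nonempty
  · have hsub : S ∩ M ⊆ T ∩ M := Finset.inter_subset_inter_right hST
    rw [nodeCost, nodeCost, dif_pos hS, dif_pos (hS.mono hsub)]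
    exact Finset.sup'_mono f hsub hS
  · rw [nodeCost, dif_neg hS]
    exact inf'_le_nodeCost M hM f T

theorem ce_singleton_le_marginal {V : Type*} [Fintype V] [DecidableEq V]
    (N : V → Finset V) (hsym : ∀ v u, u ∈ N v → v ∈ N u)
    (hirr : ∀ v, v ∉ N v) (hN : ∀ v, (N v).Nonempty)
    (τ : V → V → ℝ) (τ_min : ℝ) (hτmin : 0 < τ_min)
    (hτ : ∀ v u, u ∈ N v → τ_min ≤ τ v u)
    (ce : Finset V → ℝ)
    (hce : ∀ S : Finset V, ce S = ∑ v ∈ S,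
      (if h : (S ∩ N v).Nonempty then (S ∩ N v).sup' h (fun u => τ v u)
       else (N v).inf' (hN v) (fun u => τ v u)))
    (S : Finset V) (v : V) (hv : v ∉ S) :
    ce {v} ≤ ce (insert v S) - ce S := by
  have hcost : ∀ S, ce S = ∑ w ∈ S, nodeCost (N w) (hN w) (τ w) S := hce
  have hsingle : nodeCost (N v) (hN v) (τ v) {v} = (N v).inf' (hN v) (τ v) := by
    rw [nodeCost, dif_neg]
    simp [Finset.singleton_inter_of_notMem (hirr v)]
  rw [hcost, hcost, hcost, Finset.sum_singleton, Finset.sum_insert hv, hsingle, le_sub_iff_add_le]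
  exact add_le_add (inf'_le_nodeCost _ _ _ _)
    (Finset.sum_le_sum fun w _ => nodeCost_mono _ _ _ (Finset.subset_insert v S))
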